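/- arXiv:2506.20459 — 3 statements merged into one kernel-verified Lean document; each statement's English description precedes it below -/
import Mathlib

section
/- Let H be a Hilbert space, (v_n)_{n≥1} a bounded sequence in H, and L ∈ H such that (1/N)·Σ_{n=1}^N v_n converges to L in norm as N → ∞. Let (a_N)_{N≥1} be a sequence of positive real numbers such that the ratios a_{N+1}/a_N converge to a limit in (1, ∞] (i.e., either a_{N+1}/a_N → c for some real c > 1, or a_{N+1}/a_N → ∞). Then for all sufficiently large N the set I_N = {n ∈ ℕ : a_N < n ≤ a_{N+1}} is nonempty, and the averages (1/|I_N|)·Σ_{n∈I_N} v_n converge in norm to L as N → ∞. -/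
open Filter Finset

noncomputable section

/-- The set of integers `n` with `a N < n ≤ a (N+1)`, as a finset. -/
def dyadicBlock (a : ℕ → ℝ) (N : ℕ) : Finset ℕ :=
  (Finset.range (⌊a (N + 1)⌋₊ + 1)).filter fun n => a N < (n : ℝ) ∧ (n : ℝ) ≤ a (N + 1)

theorem dyadicBlock_eq_Ioc {a : ℕ → ℝ} (ha : ∀ N, 0 < a N) (N : ℕ) :
    dyadicBlock a N = Finset.Ioc ⌊a N⌋₊ ⌊a (N + 1)⌋₊ := by
  ext n
  simp only [dyadicBlock, Finset.mem_filter, Finset.mem_range, Finset.mem_Ioc,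
    Nat.floor_lt (ha N).le, Nat.le_floor_iff (ha (N + 1)).le, Nat.lt_succ_iff]
  tauto

/-- A positive sequence whose ratios are eventually at least `r > 1` tends to infinity. -/
theorem tendsto_atTop_of_eventually_mul_le {a : ℕ → ℝ} (ha : ∀ N, 0 < a N) {r : ℝ} (hr : 1 < r)
    (h : ∀ᶠ N in atTop, r * a N ≤ a (N + 1)) : Tendsto a atTop atTop := by
  obtain ⟨M, hM⟩ := eventually_atTop.1 h
  have hpow : ∀ k, r ^ k * a M ≤ a (k + M) := by
    intro k
    induction k with
    | zero => simp
    | succ k ih =>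
      calc r ^ (k + 1) * a M = r * (r ^ k * a M) := by ring
        _ ≤ r * a (k + M) := by gcongr
        _ ≤ a (k + M + 1) := hM _ (by omega)
        _ = a (k + 1 + M) := by congr 1; omega
  rw [← tendsto_add_atTop_iff_nat M]
  exact tendsto_atTop_mono hpow
    ((tendsto_pow_atTop_atTop_of_one_lt hr).atTop_mul_const (ha M))

/-- If the ratios of `a` tend to a limit in `(1, ∞]`, they are eventually bounded below by
some `r > 1`. -/
theorem exists_one_lt_eventually_mul_le {a : ℕ → ℝ} (ha : ∀ N, 0 < a N)
    (hratio : (∃ c : ℝ, 1 < c ∧ Tendsto (fun N => a (N + 1) / a N) atTop (nhds c)) ∨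
      Tendsto (fun N => a (N + 1) / a N) atTop atTop) :
    ∃ r : ℝ, 1 < r ∧ ∀ᶠ N in atTop, r * a N ≤ a (N + 1) := by
  rcases hratio with ⟨c, hc, h⟩ | h
  · obtain ⟨r, hr, hrc⟩ := exists_between hc
    refine ⟨r, hr, (h.eventually_const_le hrc).mono fun N hN => ?_⟩
    rwa [le_div_iff₀ (ha N)] at hN
  · refine ⟨2, one_lt_two, (h.eventually_ge_atTop 2).mono fun N hN => ?_⟩
    rwa [le_div_iff₀ (ha N)] at hN

/-- Averages over the interval `(p, q]` are close to `L` when the Cesàro averages at `p` and `q`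
are, provided that `q` is at most a multiple of `q - p`. -/
theorem norm_average_Ioc_sub_le {E : Type*} [NormedAddCommGroup E] [NormedSpace ℝ E]
    (v : ℕ → E) (L : E) {p q : ℕ} (hp : 0 < p) (hpq : p < q) {K : ℝ}
    (hK : (q : ℝ) ≤ K * ((q : ℝ) - p)) :
    ‖((Finset.Ioc p q).card : ℝ)⁻¹ • ∑ n ∈ Finset.Ioc p q, v n - L‖ ≤
      K * (‖(q : ℝ)⁻¹ • ∑ n ∈ Finset.Icc 1 q, v n - L‖ +
        ‖(p : ℝ)⁻¹ • ∑ n ∈ Finset.Icc 1 p, v n - L‖) := by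
  have hsum : ∑ n ∈ Finset.Ioc p q, v n =
      ∑ n ∈ Finset.Icc 1 q, v n - ∑ n ∈ Finset.Icc 1 p, v n := by
    rw [eq_sub_iff_add_eq']
    exact Finset.sum_Ioc_consecutive v (Nat.zero_le p) hpq.le
  have hp' : (0 : ℝ) < p := by exact_mod_cast hp
  have hpq' : (p : ℝ) < q := by exact_mod_cast hpq
  have hd : (0 : ℝ) < q - p := sub_pos.2 hpq'
  have hq' : (0 : ℝ) < q := hp'.trans hpq'
  set x := (q : ℝ)⁻¹ • ∑ n ∈ Finset.Icc 1 q, v n - L with hx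
  set y := (p : ℝ)⁻¹ • ∑ n ∈ Finset.Icc 1 p, v n - L with hy
  have hsq : ∑ n ∈ Finset.Icc 1 q, v n = (q : ℝ) • (x + L) := by
    rw [hx, sub_add_cancel, smul_inv_smul₀ hq'.ne']
  have hsp : ∑ n ∈ Finset.Icc 1 p, v n = (p : ℝ) • (y + L) := by
    rw [hy, sub_add_cancel, smul_inv_smul₀ hp'.ne']
  have key : ((Finset.Ioc p q).card : ℝ)⁻¹ • ∑ n ∈ Finset.Ioc p q, v n - L =
      ((q : ℝ) - p)⁻¹ • ((q : ℝ) • x - (p : ℝ) • y) := by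
    rw [hsum, hsq, hsp, Nat.card_Ioc, Nat.cast_sub hpq.le]
    have hL : L = ((q : ℝ) - p)⁻¹ • ((q : ℝ) - p) • L := (inv_smul_smul₀ hd.ne' L).symm
    nth_rewrite 3 [hL]
    module
  rw [key, norm_smul, norm_inv, Real.norm_of_nonneg hd.le, inv_mul_le_iff₀ hd]
  calc ‖(q : ℝ) • x - (p : ℝ) • y‖ ≤ ‖(q : ℝ) • x‖ + ‖(p : ℝ) • y‖ := norm_sub_le _ _
    _ = q * ‖x‖ + p * ‖y‖ := by
      rw [norm_smul, norm_smul, Real.norm_of_nonneg hq'.le, Real.norm_of_nonneg hp'.le]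
    _ ≤ q * (‖x‖ + ‖y‖) := by rw [mul_add]; gcongr
    _ ≤ (K * (q - p)) * (‖x‖ + ‖y‖) := by gcongr
    _ = (q - p) * (K * (‖x‖ + ‖y‖)) := by ring

/-- If the Cesàro averages of a bounded sequence `v` in a Hilbert space
converge to `L`, and `(a_N)` is a sequence of positive reals whose ratios `a_{N+1}/a_N`
converge to a limit in `(1, ∞]`, then for all sufficiently large `N` the block
`I_N = {n : a N < n ≤ a (N+1)}` is nonempty, and the block averages also converge to `L`. -/
theorem stmt2 {H : Type*} [NormedAddCommGroup H] [InnerProductSpace ℂ H] [CompleteSpace H]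
    (v : ℕ → H) (C : ℝ) (hv : ∀ n, ‖v n‖ ≤ C) (L : H)
    (hcesaro : Tendsto (fun N : ℕ => (N : ℝ)⁻¹ • ∑ n ∈ Finset.Icc 1 N, v n) atTop (nhds L))
    (a : ℕ → ℝ) (ha : ∀ N, 0 < a N)
    (hratio : (∃ c : ℝ, 1 < c ∧ Tendsto (fun N => a (N + 1) / a N) atTop (nhds c)) ∨
      Tendsto (fun N => a (N + 1) / a N) atTop atTop) :
    (∀ᶠ N in atTop, (dyadicBlock a N).Nonempty) ∧
      Tendsto (fun N => ((dyadicBlock a N).card : ℝ)⁻¹ • ∑ n ∈ dyadicBlock a N, v n)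
        atTop (nhds L) := by
  obtain ⟨r, hr, hra⟩ := exists_one_lt_eventually_mul_le ha hratio
  have hr1 : 0 < r - 1 := sub_pos.2 hr
  have htop : Tendsto a atTop atTop := tendsto_atTop_of_eventually_mul_le ha hr hra
  have hfloor : Tendsto (fun N => ⌊a N⌋₊) atTop atTop := tendsto_nat_floor_atTop.comp htop
  have hfloor' : Tendsto (fun N => ⌊a (N + 1)⌋₊) atTop atTop :=
    (tendsto_add_atTop_iff_nat 1).2 hfloor
  have hgap : ∀ᶠ N in atTop, 0 < ⌊a N⌋₊ ∧ ⌊a N⌋₊ < ⌊a (N + 1)⌋₊ ∧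
      (⌊a (N + 1)⌋₊ : ℝ) ≤ 2 * r / (r - 1) * ((⌊a (N + 1)⌋₊ : ℝ) - ⌊a N⌋₊) := by
    filter_upwards [hra, hfloor.eventually_gt_atTop 0,
      htop.eventually_ge_atTop (2 / (r - 1))] with N hN hpos hlarge
    have hlarge' : 2 ≤ a N * (r - 1) := (div_le_iff₀ hr1).1 hlarge
    have hp := Nat.floor_le (ha N).le
    have hq := Nat.floor_le (ha (N + 1)).le
    have hq' := Nat.lt_floor_add_one (a (N + 1))
    refine ⟨hpos, ?_, ?_⟩
    · have : (⌊a N⌋₊ : ℝ) < ⌊a (N + 1)⌋₊ := by nlinarith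
      exact_mod_cast this
    · rw [div_mul_eq_mul_div, le_div_iff₀ hr1]
      nlinarith
  refine ⟨hgap.mono fun N hN => ?_, ?_⟩
  · rw [dyadicBlock_eq_Ioc ha]
    exact Finset.nonempty_Ioc.2 hN.2.1
  · rw [tendsto_iff_norm_sub_tendsto_zero] at hcesaro ⊢
    have hlim := ((hcesaro.comp hfloor').add (hcesaro.comp hfloor)).const_mul (2 * r / (r - 1))
    rw [add_zero, mul_zero] at hlim
    refine squeeze_zero' (.of_forall fun _ => norm_nonneg _) (hgap.mono fun N hN => ?_) hlim
    rw [dyadicBlock_eq_Ioc ha]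
    exact norm_average_Ioc_sub_le v L hN.1 hN.2.1 hN.2.2

end
end

section
/- Let H be a complex Hilbert space, S : H → H a linear isometry, m, n ≥ 1 positive integers, and f ∈ H. If (S^m − I)((S^n − I) f) = 0, then S^{2mn} f = f. -/
noncomputable section

/-- A norm-preserving operator has no nontrivial Jordan chain at the eigenvalue `1`. -/
theorem apply_eq_self_of_isometry_of_apply_sub_eq {E : Type*} [NormedAddCommGroup E]
    [NormedSpace ℂ E] (T : E →L[ℂ] E) (hT : ∀ x, ‖T x‖ = ‖x‖) (f : E)
    (h : T (T f - f) = T f - f) : T f = f := by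
  obtain ⟨u, hu⟩ : ∃ u, u = T f - f := ⟨_, rfl⟩
  rw [← hu] at h
  have hTf : T f = f + u := by rw [hu]; abel
  have norm_add (k : ℕ) : ‖f + k • u‖ = ‖f‖ := by
    induction k with
    | zero => simp
    | succ k ih =>
      rw [← ih, ← hT (f + k • u), map_add, map_nsmul, h, hTf, succ_nsmul']
      congr 1
      abel
  have bound (k : ℕ) : k * ‖u‖ ≤ 2 * ‖f‖ := by
    calc k * ‖u‖ = ‖(f + k • u) - f‖ := by
          rw [add_sub_cancel_left, ← Nat.cast_smul_eq_nsmul ℂ, norm_smul]; simp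
      _ ≤ ‖f + k • u‖ + ‖f‖ := norm_sub_le _ _
      _ = 2 * ‖f‖ := by rw [norm_add]; ring
  have hu0 : u = 0 := by
    by_contra hne
    have hpos : 0 < ‖u‖ := norm_pos_iff.mpr hne
    obtain ⟨k, hk⟩ := exists_nat_gt (2 * ‖f‖ / ‖u‖)
    rw [div_lt_iff₀ hpos] at hk
    linarith [bound k]
  rw [hTf, hu0, add_zero]

theorem ContinuousLinearMap.pow_apply_eq_self {E : Type*} [NormedAddCommGroup E]
    [NormedSpace ℂ E] (T : E →L[ℂ] E) {x : E} (h : T x = x) (k : ℕ) : (T ^ k) x = x := by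
  induction k with
  | zero => simp
  | succ k ih => rw [pow_succ, mul_apply_eq_comp, h, ih]

theorem ContinuousLinearMap.norm_pow_apply_of_isometry {E : Type*} [NormedAddCommGroup E]
    [NormedSpace ℂ E] (T : E →L[ℂ] E) (hT : ∀ x, ‖T x‖ = ‖x‖) (k : ℕ) (x : E) :
    ‖(T ^ k) x‖ = ‖x‖ := by
  induction k with
  | zero => simp
  | succ k ih => rw [pow_succ', mul_apply_eq_comp, hT, ih]

/-- Let `S` be a linear isometry of a complex Hilbert space `H`,
`m, n ≥ 1`, and `f ∈ H`. If `(S^m − I)((S^n − I) f) = 0`, then `S^{2mn} f = f`. -/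
theorem stmt4 {H : Type*} [NormedAddCommGroup H] [InnerProductSpace ℂ H] [CompleteSpace H]
    (S : H →L[ℂ] H) (hS : ∀ x, ‖S x‖ = ‖x‖) (m n : ℕ) (hm : 1 ≤ m) (hn : 1 ≤ n)
    (f : H) (h : (S ^ m - 1) ((S ^ n - 1) f) = 0) :
    (S ^ (2 * m * n)) f = f := by
  have hg : (S ^ m) ((S ^ n - 1) f) = (S ^ n - 1) f := sub_eq_zero.mp h
  have hTg : (S ^ (m * n)) ((S ^ n - 1) f) = (S ^ n - 1) f := by
    rw [pow_mul]
    exact ContinuousLinearMap.pow_apply_eq_self _ hg n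
  obtain ⟨B, hB⟩ : ∃ B, B = ∑ i ∈ Finset.range m, (S ^ n) ^ i := ⟨_, rfl⟩
  have hu : (S ^ (m * n)) f - f = B ((S ^ n - 1) f) := by
    have hgeom : B * (S ^ n - 1) = S ^ (m * n) - 1 := by
      rw [hB, geom_sum_mul, ← pow_mul, mul_comm n m]
    rw [← mul_apply_eq_comp, hgeom]
    rfl
  have hcomm : S ^ (m * n) * B = B * S ^ (m * n) := by
    rw [hB]
    exact Commute.sum_right _ _ _ fun i _ => ((Commute.refl S).pow_pow _ _).pow_right i
  have hT : (S ^ (m * n)) f = f := by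
    refine apply_eq_self_of_isometry_of_apply_sub_eq _
      (ContinuousLinearMap.norm_pow_apply_of_isometry S hS _) f ?_
    rw [hu, ← mul_apply_eq_comp, hcomm, mul_apply_eq_comp, hTg]
  rw [mul_assoc, mul_comm 2, pow_mul]
  exact ContinuousLinearMap.pow_apply_eq_self _ hT 2

end
end

section
/- Let β, t, s ∈ ℝ and suppose that 1, β, and t − βs are linearly independent over ℚ. Then (1/N)·Σ_{n=1}^N e((t − βs)·n + {βn}·s) → 0 as N → ∞. -/
open Filter Finset

noncomputable section

/-- `e(x) = exp(2πix)`. -/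
def e (x : ℝ) : ℂ := Complex.exp (2 * (Real.pi : ℂ) * Complex.I * (x : ℂ))

theorem e_add (x y : ℝ) : e (x + y) = e x * e y := by
  simp only [e, ← Complex.exp_add]
  congr 1
  push_cast
  ring

theorem e_zero : e 0 = 1 := by simp [e]

theorem norm_e (x : ℝ) : ‖e x‖ = 1 := by
  rw [e, Complex.norm_exp]
  simp

theorem e_eq_one_iff (x : ℝ) : e x = 1 ↔ ∃ k : ℤ, x = k := by
  rw [e, Complex.exp_eq_one_iff]
  refine exists_congr fun k => ?_
  rw [mul_comm (k : ℂ), mul_right_inj' Complex.two_pi_I_ne_zero]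
  exact_mod_cast Iff.rfl

theorem e_mul_nat (x : ℝ) (n : ℕ) : e (x * n) = e x ^ n := by
  rw [e, e, ← Complex.exp_nat_mul]
  congr 1
  push_cast
  ring

theorem e_nat_mul_fract (j : ℕ) (x : ℝ) : e (j * Int.fract x) = e (j * x) := by
  have h : e (j * (⌊x⌋ : ℝ)) = 1 := (e_eq_one_iff _).2 ⟨j * ⌊x⌋, by push_cast; rfl⟩
  conv_rhs => rw [← Int.floor_add_fract x, mul_add, e_add, h, one_mul]

theorem conj_e (x : ℝ) : (starRingEnd ℂ) (e x) = e (-x) := by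
  rw [e, e, ← Complex.exp_conj]
  congr 1
  simp [Complex.conj_ofNat]

theorem continuous_e : Continuous e := by
  unfold e
  fun_prop

/-- The mean of `f 1, …, f N`. -/
def average (f : ℕ → ℂ) (N : ℕ) : ℂ := (N : ℂ)⁻¹ * ∑ n ∈ Finset.Icc 1 N, f n

theorem norm_average_le_of_norm_le {f : ℕ → ℂ} {g : ℕ → ℝ} (h : ∀ n, ‖f n‖ ≤ g n) (N : ℕ) :
    ‖average f N‖ ≤ ‖average (fun n => (g n : ℂ)) N‖ := by
  have hg : ∀ n, 0 ≤ g n := fun n => (norm_nonneg _).trans (h n)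
  rw [average, average, norm_mul, norm_mul]
  refine mul_le_mul_of_nonneg_left ?_ (norm_nonneg _)
  rw [← Complex.ofReal_sum, Complex.norm_of_nonneg (Finset.sum_nonneg fun n _ => hg n)]
  exact norm_sum_le_of_le _ fun n _ => h n

theorem average_add (f g : ℕ → ℂ) (N : ℕ) :
    average (fun n => f n + g n) N = average f N + average g N := by
  simp only [average, Finset.sum_add_distrib, mul_add]

theorem average_const_mul (c : ℂ) (f : ℕ → ℂ) (N : ℕ) :
    average (fun n => c * f n) N = c * average f N := by
  simp only [average, ← Finset.mul_sum]
  ring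

theorem average_sum {ι : Type*} (s : Finset ι) (f : ι → ℕ → ℂ) (N : ℕ) :
    average (fun n => ∑ i ∈ s, f i n) N = ∑ i ∈ s, average (f i) N := by
  simp only [average, ← Finset.mul_sum]
  rw [Finset.sum_comm]

theorem average_const (c : ℂ) {N : ℕ} (hN : N ≠ 0) : average (fun _ => c) N = c := by
  have : (N : ℂ) ≠ 0 := by exact_mod_cast hN
  simp [average, this]

theorem norm_average_le_of_norm_le_const {f : ℕ → ℂ} {c : ℝ} (h : ∀ n, ‖f n‖ ≤ c) {N : ℕ}
    (hN : N ≠ 0) : ‖average f N‖ ≤ c := by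
  refine (norm_average_le_of_norm_le h N).trans_eq ?_
  rw [average_const _ hN, Complex.norm_of_nonneg ((norm_nonneg _).trans (h 0))]

theorem tendsto_zero_of_eventually_norm_le {u : ℕ → ℂ}
    (h : ∀ ε > 0, ∃ (v : ℕ → ℝ) (c : ℝ), c < ε ∧ Tendsto v atTop (nhds c) ∧
      ∀ᶠ n in atTop, ‖u n‖ ≤ v n) : Tendsto u atTop (nhds 0) := by
  rw [Metric.tendsto_nhds]
  intro ε hε
  obtain ⟨v, c, hc, hv, hle⟩ := h ε hε
  filter_upwards [hle, hv.eventually_lt_const hc] with n h₁ h₂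
  rw [dist_zero_right]
  exact h₁.trans_lt h₂

theorem tendsto_average_e {α : ℝ} (hα : ∀ k : ℤ, α ≠ k) :
    Tendsto (average fun n => e (α * n)) atTop (nhds 0) := by
  have hz : e α - 1 ≠ 0 := by
    rw [sub_ne_zero, Ne, e_eq_one_iff]
    exact fun ⟨k, hk⟩ => hα k hk
  have hgeom : ∀ N : ℕ, (e α - 1) * ∑ n ∈ Finset.Icc 1 N, e (α * n) = e α ^ (N + 1) - e α := by
    intro N
    induction N with
    | zero => simp
    | succ N ih =>
      rw [Finset.sum_Icc_succ_top (by omega), mul_add, ih, e_mul_nat]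
      ring
  have hbound : ∀ N : ℕ, ‖average (fun n => e (α * n)) N‖ ≤ (N : ℝ)⁻¹ * (2 / ‖e α - 1‖) := by
    intro N
    rw [average, norm_mul, norm_inv, Complex.norm_natCast]
    refine mul_le_mul_of_nonneg_left ?_ (by positivity)
    rw [le_div_iff₀ (norm_pos_iff.2 hz), mul_comm, ← norm_mul, hgeom]
    refine (norm_sub_le _ _).trans_eq ?_
    rw [norm_pow, norm_e]
    norm_num
  refine squeeze_zero_norm hbound ?_
  simpa using (tendsto_inv_atTop_nhds_zero_nat (𝕜 := ℝ)).mul_const (2 / ‖e α - 1‖)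

theorem tendsto_average_e_mul_continuousMap {β θ : ℝ} (h : ∀ k m : ℤ, θ + k * β ≠ m)
    (F : C(AddCircle (1 : ℝ), ℂ)) :
    Tendsto (average fun n => e (θ * n) * F ((β * n : ℝ) : AddCircle (1 : ℝ))) atTop
      (nhds 0) := by
  have hspan : ∀ G ∈ Submodule.span ℂ (Set.range (fourier (T := (1 : ℝ)))),
      Tendsto (average fun n => e (θ * n) * G ((β * n : ℝ) : AddCircle (1 : ℝ))) atTop
        (nhds 0) := by
    intro G hG
    induction hG using Submodule.span_induction with
    | mem G hG =>
      obtain ⟨k, rfl⟩ := hG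
      convert tendsto_average_e (h k) using 2
      funext n
      rw [fourier_coe_apply, add_mul, e_add]
      congr 1
      rw [e]
      congr 1
      push_cast
      ring
    | zero =>
      refine tendsto_const_nhds.congr fun N => ?_
      simp [average]
    | add G H _ _ hG hH =>
      simpa [mul_add, funext (average_add _ _)] using hG.add hH
    | smul c G _ hG =>
      simpa [mul_left_comm _ c, funext (average_const_mul c _)] using hG.const_mul c
  refine tendsto_zero_of_eventually_norm_le fun ε hε => ?_
  have hF : F ∈ (Submodule.span ℂ (Set.range (fourier (T := (1 : ℝ))))).topologicalClosure := by
    rw [span_fourier_closure_eq_top]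
    trivial
  obtain ⟨G, hG, hFG⟩ := Metric.mem_closure_iff.1 hF (ε / 2) (half_pos hε)
  refine ⟨_, _, ?_, (hspan G hG).norm.add_const (ε / 2), ?_⟩
  · simpa using hε
  filter_upwards [eventually_ne_atTop 0] with N hN
  have hsplit := average_add
    (fun n => e (θ * n) * G ((β * n : ℝ) : AddCircle (1 : ℝ)))
    (fun n => e (θ * n) * (F - G) ((β * n : ℝ) : AddCircle (1 : ℝ))) N
  simp only [← mul_add, ContinuousMap.sub_apply, add_sub_cancel] at hsplit
  rw [hsplit]
  refine (norm_add_le _ _).trans (add_le_add_right ?_ _)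
  refine norm_average_le_of_norm_le_const (fun n => ?_) hN
  rw [norm_mul, norm_e, one_mul, ← ContinuousMap.sub_apply]
  refine ((F - G).norm_coe_le_norm _).trans ?_
  rw [← dist_eq_norm]
  exact hFG.le

/-- The normalized Fejér kernel, with value `1` at the integers. -/
def fejer (M : ℕ) (x : ℝ) : ℝ := ‖(M : ℂ)⁻¹ * ∑ j ∈ Finset.range M, e (j * x)‖ ^ 2

theorem fejer_nonneg (M : ℕ) (x : ℝ) : 0 ≤ fejer M x := by
  unfold fejer
  positivity

theorem fejer_fract (M : ℕ) (x : ℝ) : fejer M (Int.fract x) = fejer M x := by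
  simp only [fejer, e_nat_mul_fract]

theorem continuous_fejer (M : ℕ) : Continuous (fejer M) := by
  unfold fejer
  have := continuous_e
  fun_prop

theorem fejer_zero {M : ℕ} (hM : M ≠ 0) : fejer M 0 = 1 := by
  have : (M : ℂ) ≠ 0 := by exact_mod_cast hM
  simp [fejer, e_zero, this]

theorem fejer_one {M : ℕ} (hM : M ≠ 0) : fejer M 1 = 1 := by
  rw [← fejer_fract, Int.fract_one, fejer_zero hM]

theorem ofReal_fejer (M : ℕ) (x : ℝ) :
    (fejer M x : ℂ) = ((M : ℂ)⁻¹ * (M : ℂ)⁻¹) *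
      ∑ j ∈ Finset.range M, ∑ k ∈ Finset.range M, e (((j : ℝ) - k) * x) := by
  rw [fejer, Complex.ofReal_pow, ← Complex.mul_conj', map_mul, map_inv₀, Complex.conj_natCast,
    map_sum, mul_mul_mul_comm, Finset.sum_mul_sum]
  congr 1
  refine Finset.sum_congr rfl fun j _ => Finset.sum_congr rfl fun k _ => ?_
  rw [conj_e, ← e_add]
  congr 1
  ring

theorem tendsto_average_fejer {β : ℝ} (hβ : ∀ k m : ℤ, k ≠ 0 → k * β ≠ m) {M : ℕ}
    (hM : M ≠ 0) :
    Tendsto (average fun n => (fejer M (β * n) : ℂ)) atTop (nhds (M : ℂ)⁻¹) := by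
  have hM' : (M : ℂ) ≠ 0 := by exact_mod_cast hM
  have hpair : ∀ j k : ℕ, Tendsto (average fun n => e (((j : ℝ) - k) * (β * n))) atTop
      (nhds (if j = k then 1 else 0)) := by
    intro j k
    split_ifs with hjk
    · subst hjk
      refine tendsto_const_nhds.congr' ?_
      filter_upwards [eventually_ne_atTop 0] with N hN
      simp [e_zero, average_const _ hN]
    · simp only [← mul_assoc]
      refine tendsto_average_e fun m => ?_
      have := hβ ((j : ℤ) - k) m (by omega)
      exact_mod_cast this
  have hsum := (tendsto_finsetSum (Finset.range M) fun j _ =>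
    tendsto_finsetSum (Finset.range M) fun k _ => hpair j k).const_mul ((M : ℂ)⁻¹ * (M : ℂ)⁻¹)
  have hlim : ((M : ℂ)⁻¹ * (M : ℂ)⁻¹) *
      ∑ j ∈ Finset.range M, ∑ k ∈ Finset.range M, (if j = k then (1 : ℂ) else 0) = (M : ℂ)⁻¹ := by
    have : ∑ j ∈ Finset.range M, ∑ k ∈ Finset.range M, (if j = k then (1 : ℂ) else 0) = M := by
      rw [Finset.sum_congr rfl (g := fun _ => (1 : ℂ))]
      · simp
      · intro j hj
        rw [Finset.sum_ite_eq, if_pos hj]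
    rw [this, mul_assoc, inv_mul_cancel₀ hM', mul_one]
  rw [hlim] at hsum
  refine hsum.congr fun N => ?_
  simp only [ofReal_fejer, average_const_mul, average_sum]

/-- If `1, β, t − βs` are linearly independent over `ℚ`, then
`(1/N)·Σ_{n=1}^N e((t − βs)n + {βn}s) → 0`. -/
theorem stmt5 (β t s : ℝ)
    (hind : ∀ q₁ q₂ q₃ : ℚ,
      (q₁ : ℝ) + (q₂ : ℝ) * β + (q₃ : ℝ) * (t - β * s) = 0 → q₁ = 0 ∧ q₂ = 0 ∧ q₃ = 0) :
    Tendsto (fun N : ℕ => (N : ℂ)⁻¹ * ∑ n ∈ Finset.Icc 1 N,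
        e ((t - β * s) * n + Int.fract (β * n) * s)) atTop (nhds 0) := by
  have hβ : ∀ k m : ℤ, k ≠ 0 → k * β ≠ m := by
    intro k m hk h
    have := (hind (-m) k 0 (by push_cast; linarith)).2.1
    exact hk (by exact_mod_cast this)
  have hθ : ∀ k m : ℤ, (t - β * s) + k * β ≠ m := by
    intro k m h
    have := (hind (-m) k 1 (by push_cast; linarith)).2.2
    exact one_ne_zero this
  change Tendsto (average fun n => e ((t - β * s) * n + Int.fract (β * n) * s)) atTop (nhds 0)
  refine tendsto_zero_of_eventually_norm_le fun ε hε => ?_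
  obtain ⟨m, hm⟩ := exists_nat_one_div_lt hε
  have hM : m + 1 ≠ 0 := m.succ_ne_zero
  let f : ℝ → ℂ := fun x => e (x * s) * (1 - fejer (m + 1) x)
  have hf : Continuous f := by
    have h₁ := continuous_e
    have h₂ := continuous_fejer (m + 1)
    fun_prop
  let F : C(AddCircle (1 : ℝ), ℂ) := ⟨AddCircle.liftIco 1 0 f,
    AddCircle.liftIco_zero_continuous (by simp [f, fejer_zero hM, fejer_one hM]) hf.continuousOn⟩
  have hF : ∀ x : ℝ, F (x : AddCircle (1 : ℝ)) =
      e (Int.fract x * s) * (1 - fejer (m + 1) x) := by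
    intro x
    rw [← AddCircle.coe_fract, ← fejer_fract]
    exact AddCircle.liftIco_zero_coe_apply (f := f) ⟨Int.fract_nonneg x, Int.fract_lt_one x⟩
  refine ⟨_, _, ?_, (tendsto_average_e_mul_continuousMap hθ F).norm.add
    (tendsto_average_fejer hβ hM).norm, Eventually.of_forall fun N => ?_⟩
  · rw [norm_zero, zero_add, norm_inv, Complex.norm_natCast]
    simpa using hm
  have hsplit : (fun n : ℕ => e ((t - β * s) * n + Int.fract (β * n) * s)) = fun n : ℕ =>
      e ((t - β * s) * n) * F ((β * n : ℝ) : AddCircle (1 : ℝ)) +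
        e ((t - β * s) * n + Int.fract (β * n) * s) * fejer (m + 1) (β * n) := by
    funext n
    rw [hF, e_add]
    ring
  rw [hsplit, average_add]
  refine (norm_add_le _ _).trans (add_le_add_right ?_ _)
  refine norm_average_le_of_norm_le (fun n => ?_) N
  rw [norm_mul, norm_e, one_mul, Complex.norm_of_nonneg (fejer_nonneg _ _)]

end
end
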